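/- arXiv:1703.01917 — 2 statements merged into one kernel-verified Lean document; each statement's English description precedes it below -/
import Mathlib

section
/- Let F be a field of characteristic p > 0 and let P be a non-cyclic finite abelian p-group of order p^d. Then J(FP)^{p^{d−1} + p − 1} = 0; that is, the Loewy length of FP is at most p^{d−1} + p − 1. -/
set_option synthInstance.maxHeartbeats 1000000
set_option maxHeartbeats 1000000

/-- A finite sum of nilpotent elements `x i` of a commutative semiring, with
`x i ^ (m i + 1) = 0`, vanishes when raised to the power `∑ m i + 1`. -/
theorem sum_pow_sum_add_one_eq_zero {ι R : Type*} [CommSemiring R] (s : Finset ι) (x : ι → R)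
    (m : ι → ℕ) (h : ∀ i ∈ s, x i ^ (m i + 1) = 0) :
    (∑ i ∈ s, x i) ^ (∑ i ∈ s, m i + 1) = 0 := by
  classical
  induction s using Finset.induction_on with
  | empty => simp
  | insert a s ha ih =>
    rw [Finset.sum_insert ha, Finset.sum_insert ha]
    refine (Commute.all _ _).add_pow_eq_zero_of_add_le_succ_of_pow_eq_zero
      (h a (Finset.mem_insert_self a s)) (ih fun i hi => h i (Finset.mem_insert_of_mem hi)) ?_
    omega

theorem sum_pred_add_one_le_prod {ι : Type*} (s : Finset ι) (n : ι → ℕ)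
    (h : ∀ i ∈ s, 1 ≤ n i) : ∑ i ∈ s, (n i - 1) + 1 ≤ ∏ i ∈ s, n i := by
  classical
  induction s using Finset.induction_on with
  | empty => simp
  | insert a s ha ih =>
    rw [Finset.sum_insert ha, Finset.prod_insert ha]
    have h1 := h a (Finset.mem_insert_self a s)
    have h2 := ih fun i hi => h i (Finset.mem_insert_of_mem hi)
    obtain ⟨k, hk⟩ := Nat.exists_eq_add_of_le' h1
    rw [hk, Nat.add_sub_cancel]
    nlinarith [Nat.zero_le (∑ i ∈ s, (n i - 1)), Nat.zero_le k,
      Nat.mul_le_mul_left k h2]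

/-- If at least two integers `n i ≥ p` have product `p ^ d`, then
`∑ (n i - 1) + 1 ≤ p ^ (d - 1) + p - 1`. -/
theorem sum_pred_add_one_le_of_prod_eq_pow {ι : Type*} [Fintype ι] [Nontrivial ι] {p d : ℕ}
    (hp : 2 ≤ p) (n : ι → ℕ) (h : ∀ i, p ≤ n i) (hprod : ∏ i, n i = p ^ d) :
    ∑ i, (n i - 1) + 1 ≤ p ^ (d - 1) + p - 1 := by
  classical
  obtain ⟨a, b, hab⟩ := exists_pair_ne ι
  rw [← Finset.mul_prod_erase _ _ (Finset.mem_univ a)] at hprod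
  rw [← Finset.add_sum_erase _ _ (Finset.mem_univ a)]
  have hb : b ∈ Finset.univ.erase a := Finset.mem_erase.2 ⟨hab.symm, Finset.mem_univ b⟩
  have hpos : ∀ i, 1 ≤ n i := fun i => by linarith [h i]
  have hsum := sum_pred_add_one_le_prod (Finset.univ.erase a) n fun i _ => hpos i
  have hB : p ≤ ∏ i ∈ Finset.univ.erase a, n i :=
    (h b).trans (Finset.single_le_prod' (fun i _ => hpos i) hb)
  generalize ∏ i ∈ Finset.univ.erase a, n i = B at *
  generalize ∑ i ∈ Finset.univ.erase a, (n i - 1) = S at *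
  have hA := h a
  generalize n a = A at *
  have hd : d ≠ 0 := by
    rintro rfl
    nlinarith
  obtain ⟨e, rfl⟩ := Nat.exists_eq_succ_of_ne_zero hd
  rw [Nat.succ_eq_add_one, Nat.add_sub_cancel]
  rw [Nat.succ_eq_add_one, pow_succ] at hprod
  have key : A + B ≤ p ^ e + p := by
    obtain ⟨u, rfl⟩ := Nat.exists_eq_add_of_le hA
    obtain ⟨v, rfl⟩ := Nat.exists_eq_add_of_le hB
    have : p * (p + u + (p + v)) ≤ p * (p ^ e + p) := by nlinarith [Nat.zero_le (u * v)]
    exact Nat.le_of_mul_le_mul_left this (by omega)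
  omega

/-- If the ideal `K` contains `g - 1` for all `g`, then it contains the Jacobson radical of the
group algebra. -/
theorem MonoidAlgebra.jacobson_bot_le {F G : Type*} [Field F] [CommGroup G]
    (K : Ideal (MonoidAlgebra F G)) (hK : ∀ g : G, MonoidAlgebra.of F G g - 1 ∈ K) :
    Ideal.jacobson (⊥ : Ideal (MonoidAlgebra F G)) ≤ K := by
  let ε : MonoidAlgebra F G →ₐ[F] F := MonoidAlgebra.lift F F G 1
  have hε : Function.Surjective ε := fun c => ⟨algebraMap F _ c, ε.commutes c⟩
  have hmax : (RingHom.ker ε).IsMaximal := RingHom.ker_isMaximal_of_surjective ε hε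
  have hmem : ∀ x : MonoidAlgebra F G, x - algebraMap F _ (ε x) ∈ K := by
    intro x
    induction x using MonoidAlgebra.induction_linear with
    | zero => simp
    | add x y hx hy =>
      rw [map_add, map_add, add_sub_add_comm]
      exact K.add_mem hx hy
    | single g r =>
      have : MonoidAlgebra.single g r - algebraMap F _ (ε (MonoidAlgebra.single g r)) =
          algebraMap F (MonoidAlgebra F G) r * (MonoidAlgebra.of F G g - 1) := by
        simp [ε, mul_sub, MonoidAlgebra.single_mul_single]
      rw [this]
      exact K.mul_mem_left _ (hK g)
  intro x hx
  have hx0 : ε x = 0 := (sInf_le ⟨bot_le, hmax⟩ : Ideal.jacobson ⊥ ≤ RingHom.ker ε) hx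
  simpa [hx0] using hmem x

/-- Let `G` be a product of cyclic groups `C i` of order a power of the characteristic `p`.
Then `∑ (|C i| - 1) + 1` bounds the Loewy length of the group algebra of `G`. -/
theorem MonoidAlgebra.jacobson_bot_pow_eq_bot_of_mulEquiv_pi {F G ι : Type*} [Field F] {p : ℕ}
    [Fact p.Prime] [CharP F p] [CommGroup G] [Fintype ι] {C : ι → Type*} [∀ i, CommGroup (C i)]
    [∀ i, IsCyclic (C i)] (e : G ≃* ∀ i, C i) (hC : ∀ i, ∃ k, Nat.card (C i) = p ^ k) :
    Ideal.jacobson (⊥ : Ideal (MonoidAlgebra F G)) ^ (∑ i, (Nat.card (C i) - 1) + 1) = ⊥ := by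
  classical
  have : CharP (MonoidAlgebra F G) p :=
    charP_of_injective_algebraMap (algebraMap F (MonoidAlgebra F G)).injective p
  choose c hc using fun i => IsCyclic.exists_generator (α := C i)
  let x : ι → MonoidAlgebra F G := fun i =>
    MonoidAlgebra.of F G (e.symm (Pi.mulSingle i (c i))) - 1
  let I : ι → Ideal (MonoidAlgebra F G) := fun i => Ideal.span {x i}
  have hI : ∀ i, I i ^ (Nat.card (C i) - 1 + 1) = 0 := by
    intro i
    obtain ⟨k, hk⟩ := hC i
    have hpos : 1 ≤ p ^ k := Nat.one_le_pow _ _ (Fact.out : p.Prime).pos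
    rw [hk, Nat.sub_add_cancel hpos, Ideal.span_singleton_pow, Ideal.zero_eq_bot,
      Ideal.span_singleton_eq_bot]
    have h1 : c i ^ p ^ k = 1 := by rw [← hk, pow_card_eq_one']
    simp only [x]
    rw [sub_pow_char_pow, ← map_pow, ← map_pow, ← Pi.mulSingle_pow, h1,
      Pi.mulSingle_one, map_one, map_one, one_pow, sub_self]
  have hle : Ideal.jacobson (⊥ : Ideal (MonoidAlgebra F G)) ≤ ∑ i, I i := by
    refine MonoidAlgebra.jacobson_bot_le _ fun g => ?_
    let φ : (∀ i, C i) →* MonoidAlgebra F G ⧸ ∑ i, I i :=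
      ((Ideal.Quotient.mk (∑ i, I i)).toMonoidHom.comp (MonoidAlgebra.of F G)).comp
        e.symm.toMonoidHom
    have hφ : φ = 1 := by
      refine MonoidHom.functions_ext _ _ _ fun i y => ?_
      obtain ⟨m, rfl⟩ := Subgroup.mem_zpowers_iff.1 (hc i y)
      have hgen : φ.comp (MonoidHom.mulSingle C i) (c i) = 1 := by
        have hx : x i ∈ ∑ i, I i :=
          (Finset.single_le_sum (f := I) (fun _ _ => bot_le) (Finset.mem_univ i))
            (Ideal.mem_span_singleton_self _)
        have := Ideal.Quotient.eq_zero_iff_mem.2 hx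
        rw [map_sub, map_one, sub_eq_zero] at this
        exact this
      have hker : c i ∈ (φ.comp (MonoidHom.mulSingle C i)).ker := hgen
      exact zpow_mem hker m
    have hg : φ (e g) = 1 := DFunLike.congr_fun hφ (e g)
    have hφe : φ (e g) = Ideal.Quotient.mk (∑ i, I i) (MonoidAlgebra.of F G (e.symm (e g))) := rfl
    rw [← Ideal.Quotient.eq_zero_iff_mem, map_sub, map_one, sub_eq_zero]
    rw [← hg, hφe, e.symm_apply_apply]
  rw [eq_bot_iff]
  exact (Ideal.pow_right_mono hle _).trans
    (sum_pow_sum_add_one_eq_zero Finset.univ I _ fun i _ => hI i).le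

/-- If `P` is a non-cyclic finite abelian `p`-group of order `p^d` and `F` a field of
characteristic `p`, then `J(FP)^(p^(d-1)+p-1) = 0`. -/
theorem stmt13 (F : Type) [Field F] (p : ℕ) [Fact p.Prime] [CharP F p]
    (P : Type) [CommGroup P] [Fintype P] (d : ℕ)
    (hcard : Fintype.card P = p ^ d) (hnoncyclic : ¬ IsCyclic P) :
    (Ideal.jacobson (⊥ : Ideal (MonoidAlgebra F P))) ^ (p ^ (d - 1) + p - 1) = ⊥ := by
  have hp : p.Prime := Fact.out
  obtain ⟨ι, _, n, hn, ⟨e⟩⟩ := CommGroup.equiv_prod_multiplicative_zmod_of_finite P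
  have hnt : Nontrivial ι := by
    by_contra hsub
    rw [not_nontrivial_iff_subsingleton] at hsub
    apply hnoncyclic
    rcases isEmpty_or_nonempty ι with hι | ⟨⟨i⟩⟩
    · have : Subsingleton P := e.toEquiv.subsingleton
      infer_instance
    · refine isCyclic_of_injective
        ((Pi.evalMonoidHom (fun j => Multiplicative (ZMod (n j))) i).comp e.toMonoidHom) ?_
      intro a b hab
      apply e.injective
      funext j
      obtain rfl := Subsingleton.elim i j
      exact hab
  have hCn : ∀ i, Nat.card (Multiplicative (ZMod (n i))) = n i := fun i =>
    (Nat.card_congr Multiplicative.toAdd).trans (Nat.card_zmod (n i))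
  have hprod : ∏ i, n i = p ^ d := by
    rw [← hcard, ← Nat.card_eq_fintype_card, Nat.card_congr e.toEquiv, Nat.card_pi]
    simp only [hCn]
  have hpow : ∀ i, ∃ k, n i = p ^ k := fun i => by
    obtain ⟨k, -, hk⟩ := (Nat.dvd_prime_pow hp).1
      (hprod ▸ Finset.dvd_prod_of_mem n (Finset.mem_univ i))
    exact ⟨k, hk⟩
  have hle : ∀ i, p ≤ n i := fun i => by
    obtain ⟨k, hk⟩ := hpow i
    have hk0 : k ≠ 0 := by
      rintro rfl
      have := hn i
      simp [hk] at this
    rw [hk]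
    exact Nat.le_self_pow hk0 p
  have hJ := MonoidAlgebra.jacobson_bot_pow_eq_bot_of_mulEquiv_pi (F := F) (p := p) e
    fun i => by simpa [hCn] using hpow i
  simp only [hCn] at hJ
  exact eq_bot_iff.2 <| (Ideal.pow_le_pow_right
    (sum_pred_add_one_le_of_prod_eq_pow hp.two_le n hle hprod)).trans hJ.le
end

section
/- Let F be an algebraically closed field of characteristic 2, let d ≥ 4 and set n := 2^{d−2}. Let A := F[U,Y,S,T]/(Y^{n+1}, U^2 − Y^n, S^2, T^2, SY, SU, ST, UY, UT, YT) be the quotient of the polynomial ring in four variables by the listed relations. Then A is a local finite-dimensional F-algebra whose Jacobson radical J(A) is generated by the images of U, Y, S, T; one has J(A)^2 = (Y^2) (the ideal generated by the image of Y^2), J(A)^{n+1} = 0 and J(A)^n ≠ 0, so the Loewy length of A equals n + 1 = 2^{d−2} + 1. -/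
set_option synthInstance.maxHeartbeats 1000000
set_option maxHeartbeats 1000000

section LocalQuotient

variable {R : Type*} [CommRing R]

theorem Ideal.sq_span_eq_span_sq {u y s t : R} {n : ℕ} (hn : 2 ≤ n)
    (huu : u ^ 2 = y ^ n) (hss : s ^ 2 = 0) (htt : t ^ 2 = 0) (hsy : s * y = 0) (hsu : s * u = 0)
    (hst : s * t = 0) (huy : u * y = 0) (hut : u * t = 0) (hyt : y * t = 0) :
    Ideal.span {u, y, s, t} ^ 2 = Ideal.span {y ^ 2} := by
  apply le_antisymm
  · have hyn : u * u ∈ Ideal.span {y ^ 2} := by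
      rw [← sq, huu, Ideal.mem_span_singleton]
      exact pow_dvd_pow y hn
    have hyy : y * y ∈ Ideal.span {y ^ 2} := by
      rw [← sq]
      exact Ideal.mem_span_singleton_self _
    rw [sq] at hss htt
    rw [sq, Ideal.span_mul_span', Ideal.span_le]
    rintro _ ⟨a, ha, b, hb, rfl⟩
    simp only [Set.mem_insert_iff, Set.mem_singleton_iff] at ha hb
    rcases ha with rfl | rfl | rfl | rfl <;> rcases hb with rfl | rfl | rfl | rfl <;>
      first
      | exact hyn
      | exact hyy
      | (simp only [SetLike.mem_coe]
         first
         | simp only [hss, htt, hsy, hsu, hst, huy, hut, hyt, zero_mem]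
         | (rw [mul_comm]
            simp only [hsy, hsu, hst, huy, hut, hyt, zero_mem]))
  · rw [Ideal.span_singleton_le_iff_mem]
    exact Ideal.pow_mem_pow (Ideal.subset_span (by simp)) 2

theorem Ideal.span_pow_succ_eq_bot {u y s t : R} {k : ℕ} (hk : k ≠ 0)
    (hy : y ^ (2 * k + 1) = 0) (hsy : s * y = 0) (huy : u * y = 0) (hyt : y * t = 0)
    (hsq : Ideal.span {u, y, s, t} ^ 2 = Ideal.span {y ^ 2}) :
    Ideal.span {u, y, s, t} ^ (2 * k + 1) = ⊥ := by
  obtain ⟨m, hm⟩ : ∃ m, 2 * k = m + 1 := ⟨2 * k - 1, by omega⟩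
  rw [pow_succ, pow_mul, hsq, Ideal.span_singleton_pow, ← pow_mul, Ideal.span_mul_span',
    Ideal.span_eq_bot]
  rintro _ ⟨a, ha, b, hb, rfl⟩
  simp only [Set.mem_insert_iff, Set.mem_singleton_iff] at ha hb
  subst ha
  rcases hb with rfl | rfl | rfl | rfl
  · simp only [hm, pow_succ, mul_assoc, mul_comm y, huy, mul_zero]
  · simpa only [pow_succ] using hy
  · simp only [hm, pow_succ, mul_assoc, mul_comm y, hsy, mul_zero]
  · simp only [hm, pow_succ, mul_assoc, hyt, mul_zero]

variable {F : Type*} [Field F] [Algebra F R] {M : Ideal R}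

theorem IsLocalRing.of_forall_sub_algebraMap_mem [Nontrivial R] (hM : IsNilpotent M)
    (h : ∀ a : R, ∃ c : F, a - algebraMap F R c ∈ M) : IsLocalRing R := by
  obtain ⟨k, hk⟩ := hM
  have hnil : ∀ m ∈ M, IsNilpotent m := fun m hm => ⟨k, by
    simpa [hk] using Ideal.pow_mem_pow hm k⟩
  refine .of_isUnit_or_isUnit_one_sub_self fun a => ?_
  obtain ⟨c, hc⟩ := h a
  by_cases h0 : c = 0
  · right
    simp only [h0, map_zero, sub_zero] at hc
    exact (hnil a hc).isUnit_one_sub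
  · left
    have hu : IsUnit (algebraMap F R c) := (IsUnit.mk0 c h0).map _
    simpa using (hnil _ hc).isUnit_add_right_of_commute hu (Commute.all _ _)

theorem Ideal.jacobson_bot_eq_of_forall_sub_algebraMap_mem [Nontrivial R] (hM : IsNilpotent M)
    (h : ∀ a : R, ∃ c : F, a - algebraMap F R c ∈ M) : Ideal.jacobson (⊥ : Ideal R) = M := by
  obtain ⟨k, hk⟩ := hM
  have hle : M ≤ Ideal.jacobson ⊥ := fun m hm =>
    Ideal.radical_le_jacobson ⟨k, by simpa [hk] using Ideal.pow_mem_pow hm k⟩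
  refine le_antisymm (fun a ha => ?_) hle
  obtain ⟨c, hc⟩ := h a
  have hcJ : algebraMap F R c ∈ Ideal.jacobson (⊥ : Ideal R) := by
    simpa using sub_mem ha (hle hc)
  by_cases h0 : c = 0
  · simpa [h0] using hc
  · have htop := Ideal.eq_top_of_isUnit_mem _ hcJ ((IsUnit.mk0 c h0).map _)
    rw [Ideal.jacobson_eq_top_iff] at htop
    exact absurd htop bot_ne_top

theorem Module.finite_of_forall_sub_algebraMap_mem [Algebra.FiniteType F R] (hM : IsNilpotent M)
    (h : ∀ a : R, ∃ c : F, a - algebraMap F R c ∈ M) : Module.Finite F R := by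
  obtain ⟨k, hk⟩ := hM
  have : Algebra.IsIntegral F R := ⟨fun a => by
    obtain ⟨c, hc⟩ := h a
    have hzero : (a - algebraMap F R c) ^ (k + 1) = 0 := by
      rw [pow_succ, show (a - algebraMap F R c) ^ k = 0 by
        simpa [hk] using Ideal.pow_mem_pow hc k, zero_mul]
    have hint : IsIntegral F (a - algebraMap F R c) :=
      .of_pow k.succ_pos (hzero ▸ isIntegral_zero)
    simpa using hint.add (isIntegral_algebraMap (R := F) (A := R) (x := c))⟩
  exact Algebra.IsIntegral.finite

end LocalQuotient

namespace MvPolynomial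

theorem exists_sub_algebraMap_mem_span_range {σ R A : Type*} [CommRing R] [CommRing A]
    [Algebra R A] (f : MvPolynomial σ R →ₐ[R] A) (hf : Function.Surjective f) (a : A) :
    ∃ c : R, a - algebraMap R A c ∈ Ideal.span (Set.range fun i => f (X i)) := by
  obtain ⟨p, rfl⟩ := hf a
  induction p using MvPolynomial.induction_on with
  | C r => exact ⟨r, by simp [← MvPolynomial.algebraMap_eq]⟩
  | add p q hp hq =>
    obtain ⟨c, hc⟩ := hp
    obtain ⟨e, he⟩ := hq
    refine ⟨c + e, ?_⟩
    have := add_mem hc he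
    rwa [← add_sub_add_comm, ← map_add, ← map_add] at this
  | mul_X p i hp =>
    refine ⟨0, ?_⟩
    rw [map_zero, sub_zero, map_mul]
    exact Ideal.mul_mem_left _ _ (Ideal.subset_span ⟨i, rfl⟩)

theorem X_one_pow_notMem_span {F : Type*} [Field F] {n : ℕ} (hn : 3 ≤ n) :
    (X 1 ^ n : MvPolynomial (Fin 4) F) ∉ Ideal.span
      {X 1 ^ (n + 1), X 0 ^ 2 - X 1 ^ n, X 2 ^ 2, X 3 ^ 2, X 2 * X 1, X 2 * X 0, X 2 * X 3,
        X 0 * X 1, X 0 * X 3, X 1 * X 3} := by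
  classical
  set y : Fin 4 →₀ ℕ := Finsupp.single 1 n with hy
  set u : Fin 4 →₀ ℕ := Finsupp.single 0 2 with hu
  have hyu : ¬ y ≤ u := fun h => by have := h 1; simp [hy, hu] at this; omega
  have huy : ¬ u ≤ y := fun h => by have := h 0; simp [hy, hu] at this
  have key (f : MvPolynomial (Fin 4) F) (s : Fin 4 →₀ ℕ) (hsy : ¬ s ≤ y) (hsu : ¬ s ≤ u) :
      coeff y (f * monomial s 1) + coeff u (f * monomial s 1) = 0 := by
    simp [coeff_mul_monomial', hsy, hsu]
  intro hmem
  suffices H : ∀ p ∈ Ideal.span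
      {X 1 ^ (n + 1), X 0 ^ 2 - X 1 ^ n, X 2 ^ 2, X 3 ^ 2, X 2 * X 1, X 2 * X 0, X 2 * X 3,
        X 0 * X 1, X 0 * X 3, (X 1 * X 3 : MvPolynomial (Fin 4) F)},
      coeff y p + coeff u p = 0 by
    have h1 := H _ hmem
    rw [X_pow_eq_monomial, ← hy, coeff_monomial, coeff_monomial, if_pos rfl,
      if_neg fun h => hyu h.le] at h1
    simp at h1
  intro p hp
  induction hp using Submodule.closure_induction with
  | zero => simp
  | add p q _ _ hp hq =>
    rw [coeff_add, coeff_add, add_add_add_comm, hp, hq, add_zero]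
  | smul_mem f p hp =>
    rw [smul_eq_mul]
    simp only [Set.mem_insert_iff, Set.mem_singleton_iff] at hp
    rcases hp with rfl | rfl | rfl | rfl | rfl | rfl | rfl | rfl | rfl | rfl
    · rw [X_pow_eq_monomial]
      refine key f _ (fun h => ?_) fun h => ?_ <;> simpa [hy, hu] using h 1
    · rw [X_pow_eq_monomial, X_pow_eq_monomial, ← hy, ← hu, mul_sub, coeff_sub, coeff_sub]
      simp [coeff_mul_monomial', hyu, huy]
    · rw [X_pow_eq_monomial]
      refine key f _ (fun h => ?_) fun h => ?_ <;> simpa [hy, hu] using h 2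
    · rw [X_pow_eq_monomial]
      refine key f _ (fun h => ?_) fun h => ?_ <;> simpa [hy, hu] using h 3
    · rw [X, X, monomial_mul, one_mul]
      refine key f _ (fun h => ?_) fun h => ?_ <;> simpa [hy, hu] using h 2
    · rw [X, X, monomial_mul, one_mul]
      refine key f _ (fun h => ?_) fun h => ?_ <;> simpa [hy, hu] using h 2
    · rw [X, X, monomial_mul, one_mul]
      refine key f _ (fun h => ?_) fun h => ?_ <;> simpa [hy, hu] using h 2
    · rw [X, X, monomial_mul, one_mul]
      refine key f _ (fun h => ?_) fun h => ?_
      · simpa [hy] using h 0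
      · simpa [hu] using h 1
    · rw [X, X, monomial_mul, one_mul]
      refine key f _ (fun h => ?_) fun h => ?_ <;> simpa [hy, hu] using h 3
    · rw [X, X, monomial_mul, one_mul]
      refine key f _ (fun h => ?_) fun h => ?_ <;> simpa [hy, hu] using h 3

end MvPolynomial

/-- Let `F` be an algebraically closed field of characteristic `2`, `d ≥ 4`, `n = 2^(d-2)` and
`A = F[U,Y,S,T]/(Y^(n+1), U²-Yⁿ, S², T², SY, SU, ST, UY, UT, YT)`. Then `A` is a local
finite-dimensional `F`-algebra, `J(A)` is generated by the images of `U, Y, S, T`,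
`J(A)² = (Y²)`, `J(A)^(n+1) = 0` and `J(A)^n ≠ 0`, so `LL(A) = n + 1 = 2^(d-2) + 1`. -/
theorem stmt15 (F : Type) [Field F] [IsAlgClosed F] [CharP F 2]
    (d n : ℕ) (hd : 4 ≤ d) (hn : n = 2 ^ (d - 2))
    (U Y S T : MvPolynomial (Fin 4) F)
    (hU : U = MvPolynomial.X 0) (hY : Y = MvPolynomial.X 1)
    (hS : S = MvPolynomial.X 2) (hT : T = MvPolynomial.X 3)
    (I : Ideal (MvPolynomial (Fin 4) F))
    (hI : I = Ideal.span
      {Y ^ (n + 1), U ^ 2 - Y ^ n, S ^ 2, T ^ 2, S * Y, S * U, S * T, U * Y, U * T, Y * T}) :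
    IsLocalRing (MvPolynomial (Fin 4) F ⧸ I) ∧
    FiniteDimensional F (MvPolynomial (Fin 4) F ⧸ I) ∧
    Ideal.jacobson (⊥ : Ideal (MvPolynomial (Fin 4) F ⧸ I)) =
      Ideal.span {Ideal.Quotient.mk I U, Ideal.Quotient.mk I Y,
        Ideal.Quotient.mk I S, Ideal.Quotient.mk I T} ∧
    (Ideal.jacobson (⊥ : Ideal (MvPolynomial (Fin 4) F ⧸ I))) ^ 2 =
      Ideal.span {Ideal.Quotient.mk I (Y ^ 2)} ∧
    (Ideal.jacobson (⊥ : Ideal (MvPolynomial (Fin 4) F ⧸ I))) ^ (n + 1) = ⊥ ∧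
    (Ideal.jacobson (⊥ : Ideal (MvPolynomial (Fin 4) F ⧸ I))) ^ n ≠ ⊥ := by
  subst hU hY hS hT
  have hn4 : 4 ≤ n := hn ▸ Nat.pow_le_pow_right (n := 2) two_pos (show 2 ≤ d - 2 by omega)
  obtain ⟨k, hk⟩ : ∃ k, n = 2 * k := ⟨2 ^ (d - 3), by
    rw [hn, ← pow_succ', show d - 3 + 1 = d - 2 by omega]⟩
  have hYn : Ideal.Quotient.mk I (MvPolynomial.X 1) ^ n ≠ 0 := by
    rw [← map_pow, Ne, Ideal.Quotient.eq_zero_iff_mem, hI]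
    exact MvPolynomial.X_one_pow_notMem_span (by omega)
  have : Nontrivial (MvPolynomial (Fin 4) F ⧸ I) := nontrivial_of_ne _ _ hYn
  have hrel : ∀ p ∈ ({MvPolynomial.X 1 ^ (n + 1), MvPolynomial.X 0 ^ 2 - MvPolynomial.X 1 ^ n,
      MvPolynomial.X 2 ^ 2, MvPolynomial.X 3 ^ 2, MvPolynomial.X 2 * MvPolynomial.X 1,
      MvPolynomial.X 2 * MvPolynomial.X 0, MvPolynomial.X 2 * MvPolynomial.X 3,
      MvPolynomial.X 0 * MvPolynomial.X 1, MvPolynomial.X 0 * MvPolynomial.X 3,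
      MvPolynomial.X 1 * MvPolynomial.X 3} : Set (MvPolynomial (Fin 4) F)),
      Ideal.Quotient.mk I p = 0 := fun p hp => by
    rw [Ideal.Quotient.eq_zero_iff_mem, hI]
    exact Ideal.subset_span hp
  simp only [Set.mem_insert_iff, Set.mem_singleton_iff, forall_eq_or_imp, forall_eq, map_mul,
    map_sub, map_pow, sub_eq_zero] at hrel
  obtain ⟨hy, huu, hss, htt, hsy, hsu, hst, huy, hut, hyt⟩ := hrel
  have hsub (a : MvPolynomial (Fin 4) F ⧸ I) :
      ∃ c : F, a - algebraMap F _ c ∈ Ideal.span {Ideal.Quotient.mk I (MvPolynomial.X 0),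
        Ideal.Quotient.mk I (MvPolynomial.X 1), Ideal.Quotient.mk I (MvPolynomial.X 2),
        Ideal.Quotient.mk I (MvPolynomial.X 3)} := by
    obtain ⟨c, hc⟩ := MvPolynomial.exists_sub_algebraMap_mem_span_range
      (Ideal.Quotient.mkₐ F I) (Ideal.Quotient.mkₐ_surjective F I) a
    refine ⟨c, Ideal.span_mono ?_ hc⟩
    rintro _ ⟨i, rfl⟩
    fin_cases i <;> simp
  have hsq := Ideal.sq_span_eq_span_sq (by omega) huu hss htt hsy hsu hst huy hut hyt
  have hpow := Ideal.span_pow_succ_eq_bot (k := k) (by omega) (hk ▸ hy) hsy huy hyt hsq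
  rw [← hk] at hpow
  have hnil : IsNilpotent (Ideal.span {Ideal.Quotient.mk I (MvPolynomial.X 0),
      Ideal.Quotient.mk I (MvPolynomial.X 1), Ideal.Quotient.mk I (MvPolynomial.X 2),
      Ideal.Quotient.mk I (MvPolynomial.X 3)}) := ⟨n + 1, hpow⟩
  rw [Ideal.jacobson_bot_eq_of_forall_sub_algebraMap_mem hnil hsub]
  refine ⟨.of_forall_sub_algebraMap_mem hnil hsub,
    Module.finite_of_forall_sub_algebraMap_mem hnil hsub, rfl, by rw [hsq, map_pow], hpow,
    fun h => hYn ?_⟩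
  rw [← Ideal.mem_bot, ← h]
  exact Ideal.pow_mem_pow (Ideal.subset_span (by simp)) n
end
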